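/- Under the hypotheses of the Schrödinger system (positive φ, boundary conditions matching μ₀ and μ_N, A row-stochastic), the path measure M⋆ with transitions π⋆(t)(i,j) = A(i,j)φ(t+1,j)/φ(t,i) and initial distribution μ₀ minimizes KL(M‖Q) over all probability measures M on V^{N+1} with marginals μ₀ at time 0 and μ_N at time N, where Q(i₀,…,i_N) = ν₀(i₀)∏A(i_t,i_{t+1}). -/

import Mathlib

/-- Relative entropy on a finite set, with the convention `0 · log 0 = 0`. -/
noncomputable def KLdiv {X : Type*} [Fintype X] (P R : X → ℝ) : ℝ :=
  ∑ x, P x * Real.log (P x / R x)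

theorem sb_sum_cons {n N : ℕ} (f : (Fin (N + 2) → Fin n) → ℝ) :
    ∑ x, f x = ∑ y : Fin (N + 1) → Fin n, ∑ i, f (Fin.cons i y) := by
  rw [← (Fin.consEquiv (fun _ : Fin (N + 2) => Fin n)).sum_comp f, Fintype.sum_prod_type,
    Finset.sum_comm]
  rfl

theorem sb_fwd {n : ℕ} (A : Matrix (Fin n) (Fin n) ℝ) (b : Fin n → ℝ) (N : ℕ)
    (h : Fin (N + 1) → Fin n → ℝ)
    (hh : ∀ (t : Fin N) (j : Fin n), h t.succ j = ∑ i, A i j * h t.castSucc i) :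
    ∑ x : Fin (N + 1) → Fin n, h 0 (x 0) * (∏ t : Fin N, A (x t.castSucc) (x t.succ)) *
      b (x (Fin.last N)) = ∑ j, h (Fin.last N) j * b j := by
  induction N with
  | zero =>
    rw [← (Equiv.funUnique (Fin 1) (Fin n)).symm.sum_comp]
    simp
  | succ N ih =>
    have := ih (fun t => h t.succ) (fun t j => by simpa using hh t.succ j)
    rw [sb_sum_cons]
    simp only [Fin.succ_last] at this
    rw [← this]
    refine Finset.sum_congr rfl fun y _ => ?_
    have h1 := hh 0 (y 0)
    rw [h1, Finset.sum_mul, Finset.sum_mul]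
    refine Finset.sum_congr rfl fun i _ => ?_
    rw [Fin.prod_univ_succ, ← Fin.succ_last]
    simp only [Fin.cons_succ, Fin.cons_zero, Fin.castSucc_zero, ← Fin.succ_castSucc]
    ring

theorem sb_bwd {n : ℕ} (A : Matrix (Fin n) (Fin n) ℝ) (N : ℕ) (a : Fin n → ℝ)
    (φ : Fin (N + 1) → Fin n → ℝ)
    (hφ : ∀ (t : Fin N) (i : Fin n), φ t.castSucc i = ∑ j, A i j * φ t.succ j) :
    ∑ x : Fin (N + 1) → Fin n, a (x 0) * (∏ t : Fin N, A (x t.castSucc) (x t.succ)) *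
      φ (Fin.last N) (x (Fin.last N)) = ∑ j, a j * φ 0 j := by
  induction N generalizing a with
  | zero =>
    rw [← (Equiv.funUnique (Fin 1) (Fin n)).symm.sum_comp]
    simp
  | succ N ih =>
    have := ih (fun j => ∑ i, a i * A i j) (fun t => φ t.succ)
      (fun t j => by simpa using hφ t.succ j)
    rw [sb_sum_cons]
    have e : ∑ j, a j * φ 0 j = ∑ j, (∑ i, a i * A i j) * φ (Fin.succ 0) j := by
      simp only [Finset.sum_mul]
      rw [Finset.sum_comm]
      refine Finset.sum_congr rfl fun i _ => ?_
      have h1 := hφ 0 i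
      rw [Fin.castSucc_zero] at h1
      rw [h1, Finset.mul_sum]
      exact Finset.sum_congr rfl fun j _ => by ring
    rw [e, ← this]
    refine Finset.sum_congr rfl fun y _ => ?_
    rw [Finset.sum_mul, Finset.sum_mul]
    refine Finset.sum_congr rfl fun i _ => ?_
    rw [Fin.prod_univ_succ, ← Fin.succ_last]
    simp only [Fin.cons_succ, Fin.cons_zero, Fin.castSucc_zero, ← Fin.succ_castSucc]
    ring

theorem sb_marg {n : ℕ} {X : Type*} [Fintype X] (M : X → ℝ) (p : X → Fin n) (μ f : Fin n → ℝ)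
    (h : ∀ i, (∑ x, if p x = i then M x else 0) = μ i) :
    ∑ x, M x * f (p x) = ∑ i, μ i * f i := by
  simp only [← h, Finset.sum_mul]
  rw [Finset.sum_comm]
  refine Finset.sum_congr rfl fun x _ => ?_
  simp [ite_mul]

/-- optimality of the Schrödinger bridge. The Markov path measure
M⋆ with transitions π⋆(t)(i,j) = A(i,j)φ(t+1,j)/φ(t,i) and initial law μ₀
minimizes KL(·‖Q) over all probability measures on path space with time-0
marginal μ₀ and time-N marginal μ_N (competitors with KL = +∞, i.e. not
absolutely continuous w.r.t. Q, being excluded). -/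
theorem schroedinger_bridge_optimality (n N : ℕ)
    (A : Matrix (Fin n) (Fin n) ℝ)
    (hAnn : ∀ i j, 0 ≤ A i j) (hArow : ∀ i, ∑ j, A i j = 1)
    (ν₀ : Fin n → ℝ) (hν₀pos : ∀ i, 0 < ν₀ i) (hν₀sum : ∑ i, ν₀ i = 1)
    (φ φhat : Fin (N + 1) → Fin n → ℝ)
    (hφpos : ∀ t i, 0 < φ t i) (hφhatnn : ∀ t i, 0 ≤ φhat t i)
    (hφ : ∀ (t : Fin N) (i : Fin n), φ t.castSucc i = ∑ j, A i j * φ t.succ j)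
    (hφhat : ∀ (t : Fin N) (j : Fin n),
      φhat t.succ j = ∑ i, A i j * φhat t.castSucc i)
    (μ₀ μN : Fin n → ℝ)
    (hμ₀sum : ∑ i, μ₀ i = 1) (hμNsum : ∑ i, μN i = 1)
    (h0 : ∀ i, φ 0 i * φhat 0 i = μ₀ i)
    (hN : ∀ i, φ (Fin.last N) i * φhat (Fin.last N) i = μN i)
    (Q Mstar : (Fin (N + 1) → Fin n) → ℝ)
    (hQ : ∀ x, Q x = ν₀ (x 0) * ∏ t : Fin N, A (x t.castSucc) (x t.succ))
    (hMstar : ∀ x, Mstar x = μ₀ (x 0) *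
      ∏ t : Fin N, A (x t.castSucc) (x t.succ) * φ t.succ (x t.succ) /
        φ t.castSucc (x t.castSucc)) :
    ∀ M : (Fin (N + 1) → Fin n) → ℝ,
      (∀ x, 0 ≤ M x) → (∑ x, M x = 1) →
      (∀ i, (∑ x : Fin (N + 1) → Fin n, if x 0 = i then M x else 0) = μ₀ i) →
      (∀ i, (∑ x : Fin (N + 1) → Fin n,
          if x (Fin.last N) = i then M x else 0) = μN i) →
      (∀ x, Q x = 0 → M x = 0) →
      KLdiv Mstar Q ≤ KLdiv M Q := by
  intro M hM0 hM1 hMm0 hMmN hMQ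
  have hms : ∀ x, Mstar x = φhat 0 (x 0) * (∏ t : Fin N, A (x t.castSucc) (x t.succ)) *
      φ (Fin.last N) (x (Fin.last N)) := by
    intro x
    have e := (Fin.prod_univ_castSucc (fun t => φ t (x t))).symm.trans
      (Fin.prod_univ_succ (fun t => φ t (x t)))
    have hp : 0 < ∏ t : Fin N, φ t.castSucc (x t.castSucc) :=
      Finset.prod_pos fun t _ => hφpos _ _
    rw [hMstar, Finset.prod_div_distrib, Finset.prod_mul_distrib, ← h0]
    field_simp
    linear_combination (-(φhat 0 (x 0) * ∏ t : Fin N, A (x t.castSucc) (x t.succ))) * e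
  have hg : ∀ x, Mstar x = Q x * (φhat 0 (x 0) / ν₀ (x 0)) * φ (Fin.last N) (x (Fin.last N)) := by
    intro x
    have := hν₀pos (x 0)
    rw [hms, hQ]
    field_simp
  have hQ0 : ∀ x, 0 ≤ Q x := fun x => by
    rw [hQ]
    exact mul_nonneg (hν₀pos _).le (Finset.prod_nonneg fun _ _ => hAnn _ _)
  have hS0 : ∀ x, 0 ≤ Mstar x := fun x => by
    rw [hms]
    exact mul_nonneg (mul_nonneg (hφhatnn _ _) (Finset.prod_nonneg fun _ _ => hAnn _ _))
      (hφpos _ _).le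
  have hlog : ∀ x, Mstar x ≠ 0 → Q x ≠ 0 ∧ φhat 0 (x 0) / ν₀ (x 0) ≠ 0 := by
    intro x hx
    rw [hg] at hx
    exact ⟨left_ne_zero_of_mul (left_ne_zero_of_mul hx),
      right_ne_zero_of_mul (left_ne_zero_of_mul hx)⟩
  set G : Fin n → ℝ := fun i => Real.log (φhat 0 i / ν₀ i) with hG
  set H : Fin n → ℝ := fun i => Real.log (φ (Fin.last N) i) with hH
  have hL : ∀ x, Mstar x ≠ 0 →
      Real.log (Mstar x / Q x) = G (x 0) + H (x (Fin.last N)) := by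
    intro x hx
    obtain ⟨h1, h2⟩ := hlog x hx
    rw [hg, mul_assoc, mul_div_cancel_left₀ _ h1, Real.log_mul h2 (hφpos _ _).ne']
  have hfw : ∀ b : Fin n → ℝ, ∑ x, Mstar x * b (x (Fin.last N)) = ∑ i, μN i * b i := by
    intro b
    have := sb_fwd A (fun j => φ (Fin.last N) j * b j) N φhat hφhat
    simp only [← hN, hms]
    calc _ = _ := Finset.sum_congr rfl fun x _ => by ring
      _ = _ := this
      _ = _ := Finset.sum_congr rfl fun x _ => by ring
  have hbw : ∀ b : Fin n → ℝ, ∑ x, Mstar x * b (x 0) = ∑ i, μ₀ i * b i := by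
    intro b
    have := sb_bwd A N (fun j => φhat 0 j * b j) φ hφ
    simp only [← h0, hms]
    calc _ = _ := Finset.sum_congr rfl fun x _ => by ring
      _ = _ := this
      _ = _ := Finset.sum_congr rfl fun x _ => by ring
  have hS1 : ∑ x, Mstar x = 1 := by
    have := hbw (fun _ => 1)
    simpa [hμ₀sum] using this
  have e1 : KLdiv Mstar Q = ∑ i, μ₀ i * G i + ∑ i, μN i * H i := by
    rw [← hbw G, ← hfw H, ← Finset.sum_add_distrib]
    refine Finset.sum_congr rfl fun x _ => ?_
    by_cases hx : Mstar x = 0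
    · simp [hx]
    · rw [hL x hx]; ring
  have e2 : ∑ x, (M x * G (x 0) + M x * H (x (Fin.last N)) + (M x - Mstar x)) =
      ∑ i, μ₀ i * G i + ∑ i, μN i * H i := by
    rw [Finset.sum_add_distrib, Finset.sum_add_distrib, Finset.sum_sub_distrib, hM1, hS1,
      sb_marg M (fun x => x 0) μ₀ G hMm0, sb_marg M (fun x => x (Fin.last N)) μN H hMmN]
    ring
  rw [e1, ← e2]
  refine Finset.sum_le_sum fun x _ => ?_
  rcases (hM0 x).eq_or_lt with hx | hx
  · simp [← hx, hS0 x]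
  have hQx : Q x ≠ 0 := fun h => hx.ne' (hMQ x h)
  have hμ : 0 < μ₀ (x 0) := by
    rw [← hMm0]
    refine lt_of_lt_of_le hx ?_
    have := Finset.single_le_sum (f := fun y : Fin (N + 1) → Fin n => if y 0 = x 0 then M y else 0)
      (fun y _ => by
        show 0 ≤ if y 0 = x 0 then M y else 0
        split_ifs
        · exact hM0 y
        · exact le_rfl) (Finset.mem_univ x)
    simpa using this
  have hh : φhat 0 (x 0) ≠ 0 := by
    rw [← h0] at hμ
    exact right_ne_zero_of_mul hμ.ne'
  have hSx : Mstar x ≠ 0 := by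
    rw [hg]
    exact mul_ne_zero (mul_ne_zero hQx (div_ne_zero hh (hν₀pos _).ne')) (hφpos _ _).ne'
  have hSp : 0 < Mstar x := lt_of_le_of_ne (hS0 x) hSx.symm
  have l1 : Real.log (M x / Q x) = Real.log (M x / Mstar x) + (G (x 0) + H (x (Fin.last N))) := by
    rw [← hL x hSx, ← Real.log_mul (div_ne_zero hx.ne' hSx) (div_ne_zero hSx hQx)]
    congr 1
    field_simp
  have l2 := Real.one_sub_inv_le_log_of_pos (div_pos hx hSp)
  have l3 := mul_le_mul_of_nonneg_left l2 hx.le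
  have l4 : M x * (1 - (M x / Mstar x)⁻¹) = M x - Mstar x := by
    field_simp
  rw [l1]
  linarith
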